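/- Let T be an invertible real n×n matrix with ‖T‖ < 1, let D = {d₁,…,d_q} ⊂ ℝⁿ, and let F be the attractor of {φ_j(x) = T(x + d_j)}. If every outward unit normal vector of every (n−1)-dimensional face of conv(D) is an eigenvector of (Tᵀ)^{-k} for some k ≥ 1, then conv(F) is a polytope (has finitely many extreme points). -/

import Mathlib

open Matrix

/-- The operator norm of a real `n × n` matrix. -/
noncomputable def opNorm {n : ℕ} (M : Matrix (Fin n) (Fin n) ℝ) : ℝ :=
  ‖Matrix.toEuclideanCLM (𝕜 := ℝ) M‖

/-- The standard inner product on `ℝⁿ`. -/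
def dotp {n : ℕ} (v x : Fin n → ℝ) : ℝ := ∑ i, v i * x i

/-- The face of a compact convex set `K` in direction `v`: the set of points of `K`
maximizing the linear functional `⟨v, ·⟩`. -/
def suppFace {n : ℕ} (K : Set (Fin n → ℝ)) (v : Fin n → ℝ) : Set (Fin n → ℝ) :=
  {x ∈ K | ∀ y ∈ K, dotp v y ≤ dotp v x}

section Polytopes

open Module Set Pointwise

variable {E : Type*} [NormedAddCommGroup E] [NormedSpace ℝ E]

theorem subset_of_subset_image_add_of_image_add_subset {T : E →L[ℝ] E} (hT : ‖T‖ < 1)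
    {A B D : Set E} (hA : IsCompact A) (hB : IsCompact B) (hBne : B.Nonempty)
    (hAT : A ⊆ T '' (A + D)) (hBT : T '' (B + D) ⊆ B) : A ⊆ B := by
  rcases A.eq_empty_or_nonempty with rfl | hAne
  · exact empty_subset _
  obtain ⟨a, ha, hmax⟩ := hA.exists_isMaxOn hAne (Metric.continuous_infDist_pt B).continuousOn
  have hzero : Metric.infDist a B ≤ 0 := by
    obtain ⟨_, ⟨a', ha', p, hp, rfl⟩, hTa⟩ := hAT ha
    obtain ⟨b, hb, hdist⟩ := hB.exists_infDist_eq_dist hBne a'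
    have h1 : Metric.infDist a B ≤ dist a (T (b + p)) :=
      Metric.infDist_le_dist_of_mem (hBT ⟨_, add_mem_add hb hp, rfl⟩)
    have h2 : dist a (T (b + p)) ≤ ‖T‖ * dist a' b := by
      rw [← hTa, dist_eq_norm, dist_eq_norm, ← map_sub]
      simpa using T.le_opNorm (a' + p - (b + p))
    have h3 : Metric.infDist a' B ≤ Metric.infDist a B := hmax ha'
    have h4 := Metric.infDist_nonneg (x := a) (s := B)
    rw [← hdist] at h2
    nlinarith [mul_le_mul_of_nonneg_left h3 (norm_nonneg T)]
  intro x hx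
  have hx0 : Metric.infDist x B ≤ Metric.infDist a B := hmax hx
  exact (hB.isClosed.mem_iff_infDist_zero hBne).2
    (le_antisymm (hx0.trans hzero) Metric.infDist_nonneg)

/-- The functionals bounded by `1` on the translate `D - c`. -/
def polarAt (D : Set E) (c : E) : Set (StrongDual ℝ E) :=
  {φ | ∀ x ∈ D, φ (x - c) ≤ 1}

theorem convex_polarAt (D : Set E) (c : E) : Convex ℝ (polarAt D c) := by
  intro φ hφ ψ hψ a b ha hb hab x hx
  have h1 := hφ x hx
  have h2 := hψ x hx
  simp only [_root_.add_apply, _root_.smul_apply, smul_eq_mul]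
  nlinarith

theorem le_one_of_mem_polarAt {D : Set E} {c : E} {φ : StrongDual ℝ E} (hφ : φ ∈ polarAt D c)
    {x : E} (hx : x ∈ convexHull ℝ D) : φ (x - c) ≤ 1 := by
  have hconv : Convex ℝ {y | φ y ≤ 1 + φ c} := convex_halfSpace_le φ.toLinearMap.isLinear _
  have := convexHull_min (s := D) (t := {y | φ y ≤ 1 + φ c}) (fun y hy => by
    have := hφ y hy
    rw [map_sub] at this
    simp only [mem_ofPred_eq]
    linarith) hconv hx
  simp only [mem_ofPred_eq] at this
  rw [map_sub]
  linarith

theorem exists_mem_polarAt_one_lt {D : Set E} {c x : E} (hc : c ∈ convexHull ℝ D)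
    (hcl : IsClosed (convexHull ℝ D)) (hx : x ∉ convexHull ℝ D) :
    ∃ φ ∈ polarAt D c, 1 < φ (x - c) := by
  obtain ⟨f, u, hu, hux⟩ := geometric_hahn_banach_closed_point (convex_convexHull ℝ D) hcl hx
  have hs : 0 < u - f c := sub_pos.2 (hu c hc)
  refine ⟨(u - f c)⁻¹ • f, fun y hy => ?_, ?_⟩
  · have := hu y (subset_convexHull ℝ D hy)
    rw [_root_.smul_apply, smul_eq_mul, map_sub, inv_mul_le_iff₀ hs]
    linarith
  · rw [_root_.smul_apply, smul_eq_mul, map_sub, lt_inv_mul_iff₀ hs]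
    linarith

/-- The points of `K` at which the functional `φ` is maximal on `K`. -/
def maxFace (K : Set E) (φ : StrongDual ℝ E) : Set E :=
  {x ∈ K | ∀ y ∈ K, φ y ≤ φ x}

theorem comp_pow_eq_smul {A : E →L[ℝ] E} {φ : StrongDual ℝ E} {μ : ℝ} (h : φ ∘L A = μ • φ)
    (m : ℕ) : φ ∘L A ^ m = μ ^ m • φ := by
  induction m with
  | zero => ext x; simp
  | succ m ih =>
    ext x
    have h1 : φ (A x) = μ * φ x := congrArg (fun g : StrongDual ℝ E => g x) h
    have h2 : φ ((A ^ m) (A x)) = μ ^ m * φ (A x) :=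
      congrArg (fun g : StrongDual ℝ E => g (A x)) ih
    rw [pow_succ]
    change φ ((A ^ m) (A x)) = μ ^ (m + 1) * φ x
    rw [h2, h1]
    ring

theorem extremePoints_subset_image_add {T : E →L[ℝ] E} (hinj : Function.Injective T)
    {G D : Set E} (hG : G = T '' (G + convexHull ℝ D)) :
    G.extremePoints ℝ ⊆ T '' (G.extremePoints ℝ + D) := by
  intro x hx
  obtain ⟨_, ⟨g, hg, p, hp, rfl⟩, rfl⟩ := hG ▸ hx.1
  have hmem : ∀ g' ∈ G, ∀ p' ∈ convexHull ℝ D, T (g' + p') ∈ G := fun g' hg' p' hp' => by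
    rw [hG]
    exact ⟨_, add_mem_add hg' hp', rfl⟩
  have hext := (mem_extremePoints.1 hx).2
  refine ⟨_, add_mem_add (mem_extremePoints.2 ⟨hg, fun g₁ h₁ g₂ h₂ hseg => ?_⟩)
    (extremePoints_convexHull_subset (𝕜 := ℝ) (mem_extremePoints.2
      ⟨hp, fun p₁ h₁ p₂ h₂ hseg => ?_⟩)), rfl⟩
  · obtain ⟨a, b, ha, hb, hab, rfl⟩ := hseg
    have := hext _ (hmem g₁ h₁ p hp) _ (hmem g₂ h₂ p hp) ⟨a, b, ha, hb, hab, by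
      rw [← map_smul, ← map_smul, ← map_add, smul_add, smul_add, add_add_add_comm, ← add_smul, hab,
        one_smul]⟩
    exact ⟨add_right_cancel (hinj this.1), add_right_cancel (hinj this.2)⟩
  · obtain ⟨a, b, ha, hb, hab, rfl⟩ := hseg
    have := hext _ (hmem g hg p₁ h₁) _ (hmem g hg p₂ h₂) ⟨a, b, ha, hb, hab, by
      rw [← map_smul, ← map_smul, ← map_add, smul_add, smul_add, add_add_add_comm, ← add_smul, hab,
        one_smul]⟩
    exact ⟨add_left_cancel (hinj this.1), add_left_cancel (hinj this.2)⟩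

theorem convexHull_attractor_eq {T : E →L[ℝ] E} (hT : ‖T‖ < 1) (hinj : Function.Injective T)
    {D F V : Set E} (hFne : F.Nonempty) (hFcpt : IsCompact F) (hF : F = T '' (F + D))
    (hV : V.Finite) (hVne : V.Nonempty)
    (hG : convexHull ℝ V = T '' (convexHull ℝ V + convexHull ℝ D)) :
    convexHull ℝ F = convexHull ℝ V := by
  have hcpt := hV.isCompact_convexHull ℝ
  apply subset_antisymm
  · refine convexHull_min ?_ (convex_convexHull ℝ V)
    refine subset_of_subset_image_add_of_image_add_subset hT hFcpt hcpt hVne.convexHull hF.subset ?_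
    exact (image_mono (add_subset_add_left (subset_convexHull ℝ D))).trans hG.symm.subset
  · have hXfin : ((convexHull ℝ V).extremePoints ℝ).Finite :=
      hV.subset extremePoints_convexHull_subset
    have hXF := subset_of_subset_image_add_of_image_add_subset hT hXfin.isCompact hFcpt hFne
      (extremePoints_subset_image_add hinj hG) hF.symm.subset
    rw [← closure_convexHull_extremePoints hcpt (convex_convexHull ℝ V),
      (hXfin.isClosed_convexHull ℝ).closure_eq]
    exact convexHull_mono hXF

/-- The set `s` is the convex hull of a finite set. -/
def IsPolytope (s : Set E) : Prop :=
  ∃ V : Set E, V.Finite ∧ s = convexHull ℝ V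

theorem IsPolytope.add {s t : Set E} (hs : IsPolytope s) (ht : IsPolytope t) :
    IsPolytope (s + t) := by
  obtain ⟨V, hV, rfl⟩ := hs
  obtain ⟨W, hW, rfl⟩ := ht
  exact ⟨V + W, hV.add hW, (convexHull_add V W).symm⟩

theorem isPolytope_zero : IsPolytope (0 : Set E) :=
  ⟨0, finite_zero, by simp [← singleton_zero]⟩

theorem IsPolytope.image {s : Set E} (hs : IsPolytope s) (f : E →ₗ[ℝ] E) :
    IsPolytope (f '' s) := by
  obtain ⟨V, hV, rfl⟩ := hs
  exact ⟨f '' V, hV.image f, f.image_convexHull V⟩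

variable [FiniteDimensional ℝ E]

theorem isCompact_polarAt {D : Set E} {c : E} (hc : c ∈ interior (convexHull ℝ D)) :
    IsCompact (polarAt D c) := by
  have hclosed : IsClosed (polarAt D c) := by
    simp only [polarAt, ofPred_forall]
    exact isClosed_biInter fun x _ => isClosed_le (by fun_prop) continuous_const
  obtain ⟨r, hr, hball⟩ := Metric.mem_nhds_iff.1 (mem_interior_iff_mem_nhds.1 hc)
  refine Metric.isCompact_of_isClosed_isBounded hclosed
    ((Metric.isBounded_closedBall (x := 0) (r := (r / 2)⁻¹)).subset fun φ hφ => ?_)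
  rw [mem_closedBall_zero_iff]
  have hle : ∀ y : E, ‖y‖ ≤ r / 2 → φ y ≤ 1 := fun y hy => by
    have hmem : c + y ∈ convexHull ℝ D := hball (by
      rw [Metric.mem_ball, dist_eq_norm, add_sub_cancel_left]
      linarith)
    simpa using le_one_of_mem_polarAt hφ hmem
  refine ContinuousLinearMap.opNorm_le_of_unit_norm (by positivity) fun x hx => ?_
  have hnorm : ‖(r / 2) • x‖ ≤ r / 2 := by
    rw [norm_smul, hx, Real.norm_of_nonneg (by positivity), mul_one]
  have h1 := hle _ hnorm
  have h2 := hle _ ((norm_neg ((r / 2) • x)).trans_le hnorm)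
  rw [map_neg, map_smul, smul_eq_mul] at h2
  rw [map_smul, smul_eq_mul] at h1
  rw [Real.norm_eq_abs, ← one_div, le_div_iff₀ (by positivity)]
  rcases abs_cases (φ x) with ⟨h, _⟩ | ⟨h, _⟩ <;> rw [h] <;> linarith

theorem span_active_eq_top {D : Set E} (hD : D.Finite) {c : E} {φ : StrongDual ℝ E}
    (hφ : φ ∈ (polarAt D c).extremePoints ℝ) :
    Submodule.span ℝ ((· - c) '' {x ∈ D | φ (x - c) = 1}) = ⊤ := by
  by_contra hne
  obtain ⟨f, hf0, hf⟩ := Submodule.exists_le_ker_of_lt_top _ (lt_top_iff_ne_top.2 hne)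
  set ψ : StrongDual ℝ E := LinearMap.toContinuousLinearMap f
  have hψ0 : ψ ≠ 0 := fun h => hf0 (by
    ext x
    simpa [ψ] using congrArg (fun g : StrongDual ℝ E => g x) h)
  have hactive : ∀ x ∈ D, φ (x - c) = 1 → ψ (x - c) = 0 := fun x hx h1 =>
    hf (Submodule.subset_span ⟨x, ⟨hx, h1⟩, rfl⟩)
  have hsmall : ∀ᶠ t : ℝ in nhds 0, ∀ x ∈ D, φ (x - c) < 1 → φ (x - c) + t * ψ (x - c) < 1 := by
    rw [Filter.eventually_all_finite hD]
    intro x _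
    by_cases h : φ (x - c) < 1
    · have hcont : Continuous fun t : ℝ => φ (x - c) + t * ψ (x - c) := by fun_prop
      filter_upwards [hcont.continuousAt.eventually_lt (continuousAt_const (y := (1 : ℝ)))
        (by simpa using h)] with t ht _ using ht
    · exact Filter.Eventually.of_forall fun t h' => absurd h' h
  have hmem : ∀ᶠ t : ℝ in nhds 0, φ + t • ψ ∈ polarAt D c := by
    filter_upwards [hsmall] with t ht x hx
    simp only [_root_.add_apply, _root_.smul_apply, smul_eq_mul]
    rcases (hφ.1 x hx).lt_or_eq with h | h
    · exact (ht x hx h).le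
    · rw [h, hactive x hx h]
      simp
  have hmem' : ∀ᶠ t : ℝ in nhds 0, φ + (-t) • ψ ∈ polarAt D c :=
    (continuous_neg.tendsto' (0 : ℝ) 0 neg_zero).eventually hmem
  obtain ⟨ε, hε, hball⟩ := Metric.eventually_nhds_iff.1 (hmem.and hmem')
  have h := hball (y := ε / 2) (by rw [dist_zero_right, Real.norm_eq_abs, abs_of_pos] <;> linarith)
  have heq := ((mem_extremePoints.1 hφ).2 _ h.1 _ h.2
    ⟨1 / 2, 1 / 2, by norm_num, by norm_num, by norm_num, by module⟩).1
  have : (ε / 2) • ψ = 0 := by simpa using heq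
  rcases smul_eq_zero.1 this with h0 | h0
  · linarith
  · exact hψ0 h0

theorem finite_extremePoints_polarAt {D : Set E} (hD : D.Finite) (c : E) :
    ((polarAt D c).extremePoints ℝ).Finite := by
  refine Set.Finite.of_injOn (f := fun φ => {x ∈ D | φ (x - c) = 1}) (t := 𝒫 D)
    (fun φ _ => sep_subset _ _) (fun φ hφ ψ hψ h => ?_) hD.finite_subsets
  have hspan := span_active_eq_top hD hφ
  apply ContinuousLinearMap.coe_injective
  refine LinearMap.ext_on hspan ?_
  rintro _ ⟨x, hx, rfl⟩
  have hx' : x ∈ {x ∈ D | ψ (x - c) = 1} := (Set.ext_iff.1 h x).1 hx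
  exact hx.2.trans hx'.2.symm

theorem finrank_vectorSpan_maxFace {D : Set E} (hD : D.Finite) {c : E} {φ : StrongDual ℝ E}
    (hφ : φ ∈ (polarAt D c).extremePoints ℝ) (hφ0 : φ ≠ 0) :
    finrank ℝ (vectorSpan ℝ (maxFace (convexHull ℝ D) φ)) + 1 = finrank ℝ E := by
  have hspan := span_active_eq_top hD hφ
  have hface : ∀ x ∈ D, φ (x - c) = 1 → x ∈ maxFace (convexHull ℝ D) φ := fun x hx h1 =>
    ⟨subset_convexHull ℝ D hx, fun y hy => by
      have := le_one_of_mem_polarAt hφ.1 hy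
      rw [map_sub] at this h1
      linarith⟩
  obtain ⟨x₀, hx₀, h₀⟩ : ∃ x ∈ D, φ (x - c) = 1 := by
    by_contra! h
    have hempty : {x ∈ D | φ (x - c) = 1} = ∅ := eq_empty_of_forall_notMem fun x hx => h x hx.1 hx.2
    rw [hempty, image_empty, Submodule.span_empty] at hspan
    refine hφ0 (ContinuousLinearMap.ext fun x => ?_)
    have : x ∈ (⊥ : Submodule ℝ E) := hspan ▸ Submodule.mem_top
    rw [(Submodule.mem_bot ℝ).1 this, map_zero, map_zero]
  have hker : vectorSpan ℝ (maxFace (convexHull ℝ D) φ) = LinearMap.ker φ.toLinearMap := by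
    apply le_antisymm
    · rw [vectorSpan_def, Submodule.span_le]
      rintro _ ⟨x, hx, y, hy, rfl⟩
      have := le_antisymm (hy.2 x hx.1) (hx.2 y hy.1)
      simp [this]
    · have hle : Submodule.span ℝ ((· - c) '' {x ∈ D | φ (x - c) = 1}) ≤
          (vectorSpan ℝ (maxFace (convexHull ℝ D) φ)).comap
            (LinearMap.id - φ.toLinearMap.smulRight (x₀ - c)) := by
        rw [Submodule.span_le]
        rintro _ ⟨x, hx, rfl⟩
        have := vsub_mem_vectorSpan ℝ (hface x hx.1 hx.2) (hface x₀ hx₀ h₀)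
        simpa [-map_sub, hx.2] using this
      intro y hy
      have := hle (hspan ▸ Submodule.mem_top : y ∈ _)
      simpa [LinearMap.mem_ker.1 hy] using this
  rw [hker]
  exact Module.Dual.finrank_ker_add_one_of_ne_zero (f := φ.toLinearMap)
    fun h => hφ0 (ContinuousLinearMap.coe_injective h)

theorem mem_convexHull_of_forall_extremePoints_polarAt {D : Set E} (hD : D.Finite) {c x : E}
    (hc : c ∈ interior (convexHull ℝ D))
    (hx : ∀ φ ∈ (polarAt D c).extremePoints ℝ, φ (x - c) ≤ 1) : x ∈ convexHull ℝ D := by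
  by_contra hxD
  obtain ⟨φ, hφ, hlt⟩ := exists_mem_polarAt_one_lt (interior_subset hc)
    (hD.isClosed_convexHull ℝ) hxD
  rw [← closure_convexHull_extremePoints (isCompact_polarAt hc) (convex_polarAt D c)] at hφ
  have hclosed : IsClosed {ψ : StrongDual ℝ E | ψ (x - c) ≤ 1} :=
    isClosed_le (by fun_prop) continuous_const
  have hconv : Convex ℝ {ψ : StrongDual ℝ E | ψ (x - c) ≤ 1} :=
    convex_halfSpace_le ⟨fun _ _ => rfl, fun _ _ => rfl⟩ 1
  exact absurd (closure_minimal (convexHull_min hx hconv) hclosed hφ) (not_le.2 hlt)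

theorem exists_pow_sub_add_mem_convexHull {T : E →L[ℝ] E} (hT : ‖T‖ < 1) {D : Set E}
    (hD : D.Finite) (hint : (interior (convexHull ℝ D)).Nonempty)
    (heig : ∀ φ : StrongDual ℝ E, φ ≠ 0 →
      finrank ℝ (vectorSpan ℝ (maxFace (convexHull ℝ D) φ)) + 1 = finrank ℝ E →
      ∃ k : ℕ, 1 ≤ k ∧ ∃ μ : ℝ, φ ∘L T ^ k = μ • φ) :
    ∃ K : ℕ, 1 ≤ K ∧ ∀ p ∈ convexHull ℝ D, ∀ p' ∈ convexHull ℝ D,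
      p - (T ^ K) p + (T ^ K) p' ∈ convexHull ℝ D := by
  obtain ⟨c, hc⟩ := hint
  have hfin := finite_extremePoints_polarAt hD c
  have hex : ∀ φ : StrongDual ℝ E, ∃ k : ℕ, 1 ≤ k ∧
      (φ ∈ (polarAt D c).extremePoints ℝ → ∃ μ : ℝ, φ ∘L T ^ k = μ • φ) := by
    intro φ
    by_cases hφ : φ ∈ (polarAt D c).extremePoints ℝ
    · by_cases h0 : φ = 0
      · exact ⟨1, le_rfl, fun _ => ⟨0, by simp [h0]⟩⟩
      · obtain ⟨k, hk, hμ⟩ := heig φ h0 (finrank_vectorSpan_maxFace hD hφ h0)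
        exact ⟨k, hk, fun _ => hμ⟩
    · exact ⟨1, le_rfl, fun h => absurd h hφ⟩
  choose k hk hμ using hex
  set N := ∏ φ ∈ hfin.toFinset, k φ
  have hNpos : 1 ≤ N := Finset.one_le_prod' fun φ _ => hk φ
  refine ⟨N * 2, by omega, fun p hp p' hp' =>
    mem_convexHull_of_forall_extremePoints_polarAt hD hc fun φ hφ => ?_⟩
  have hp1 := le_one_of_mem_polarAt hφ.1 hp
  have hp2 := le_one_of_mem_polarAt hφ.1 hp'
  by_cases h0 : φ = 0
  · simp [h0]
  obtain ⟨μ, hμφ⟩ := hμ φ hφ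
  obtain ⟨m, hm⟩ : k φ ∣ N := Finset.dvd_prod_of_mem k (hfin.mem_toFinset.2 hφ)
  obtain ⟨lam, hlam0, hlam⟩ : ∃ lam : ℝ, 0 ≤ lam ∧ φ ∘L T ^ (N * 2) = lam • φ :=
    ⟨(μ ^ m) ^ 2, sq_nonneg _, by
      rw [hm, pow_mul, pow_mul]
      exact comp_pow_eq_smul (comp_pow_eq_smul hμφ m) 2⟩
  have hlam1 : lam ≤ 1 := by
    have h1 : ‖lam • φ‖ ≤ ‖φ‖ * ‖T ^ (N * 2)‖ := hlam ▸ φ.opNorm_comp_le _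
    have h2 : ‖T ^ (N * 2)‖ ≤ 1 :=
      (norm_pow_le' T (by omega)).trans (pow_le_one₀ (norm_nonneg _) hT.le)
    rw [norm_smul, Real.norm_of_nonneg hlam0] at h1
    have h3 := norm_pos_iff.2 h0
    nlinarith
  have happ : ∀ x, φ ((T ^ (N * 2)) x) = lam * φ x := fun x =>
    congrArg (fun g : StrongDual ℝ E => g x) hlam
  rw [map_sub] at hp1 hp2
  rw [map_sub, map_add, map_sub, happ, happ]
  nlinarith

theorem exists_isPolytope_eq_image_add {T : E →L[ℝ] E} (hT : ‖T‖ < 1) {D : Set E}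
    (hD : D.Finite) (hDne : D.Nonempty) {K : ℕ} (hK : 1 ≤ K)
    (hinv : ∀ p ∈ convexHull ℝ D, ∀ p' ∈ convexHull ℝ D,
      p - (T ^ K) p + (T ^ K) p' ∈ convexHull ℝ D) :
    ∃ G : Set E, IsPolytope G ∧ G.Nonempty ∧ G = T '' (G + convexHull ℝ D) := by
  set P := convexHull ℝ D
  have hSlt : ‖T ^ K‖ < 1 :=
    (norm_pow_le' T hK).trans_lt (pow_lt_one₀ (norm_nonneg _) hT (by omega))
  set S : E →ₗ[ℝ] E := (T ^ K).toLinearMap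
  have hRinj : Function.Injective (LinearMap.id - S : E →ₗ[ℝ] E) := by
    rw [← LinearMap.ker_eq_bot, LinearMap.ker_eq_bot']
    intro x hx
    have hx' : x = (T ^ K) x := sub_eq_zero.1 hx
    by_contra h0
    have h1 := (T ^ K).le_opNorm x
    rw [← hx'] at h1
    have := norm_pos_iff.2 h0
    nlinarith
  set R := LinearEquiv.ofInjectiveEndo _ hRinj
  have hRapp : ∀ x, R x = x - (T ^ K) x := fun x => rfl
  set Q : Set E := R.symm '' P with hQ
  have hQmem : ∀ x, x ∈ Q ↔ x - (T ^ K) x ∈ P := fun x => by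
    rw [hQ, ← hRapp, R.image_symm_eq_preimage, mem_preimage]
  have hQpoly : IsPolytope Q := IsPolytope.image ⟨D, hD, rfl⟩ R.symm.toLinearMap
  have hQne : Q.Nonempty := hDne.convexHull.image _
  have hQeq : (T ^ K) '' Q + P = Q := by
    apply subset_antisymm
    · rintro _ ⟨_, ⟨x, hx, rfl⟩, p, hp, rfl⟩
      rw [hQmem] at hx ⊢
      convert hinv p hp _ hx using 1
      simp only [map_add, map_sub]
      abel
    · intro x hx
      exact ⟨_, ⟨x, hx, rfl⟩, _, (hQmem x).1 hx, by simp⟩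
  obtain ⟨m, rfl⟩ : ∃ m, K = m + 1 := ⟨K - 1, by omega⟩
  set f : ℕ → Set E := fun i => (T ^ (i + 1)) '' Q with hf
  have hTf : ∀ i, T '' f i = f (i + 1) := fun i => by
    simp only [hf]
    rw [image_image, pow_succ' T (i + 1)]
    rfl
  refine ⟨∑ i ∈ Finset.range (m + 1), f i, ?_, ?_, ?_⟩
  · exact Finset.sum_induction f IsPolytope (fun _ _ => IsPolytope.add) isPolytope_zero
      fun i _ => hQpoly.image (T ^ (i + 1)).toLinearMap
  · exact Finset.sum_induction f Set.Nonempty (fun _ _ => Nonempty.add) zero_nonempty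
      fun i _ => hQne.image _
  · have h0 : f (m + 1) + T '' P = f 0 := by
      rw [← hTf, ← image_add, hf]
      simp only [hQeq, zero_add, pow_one]
    rw [image_add, image_finsetSum, Finset.sum_congr rfl fun i _ => hTf i,
      Finset.sum_range_succ fun i => f (i + 1), add_assoc, h0, Finset.sum_range_succ']

theorem exists_finite_convexHull_attractor_eq {T : E →L[ℝ] E} (hT : ‖T‖ < 1)
    (hinj : Function.Injective T) {D F : Set E} (hD : D.Finite)
    (hint : (interior (convexHull ℝ D)).Nonempty)
    (hFne : F.Nonempty) (hFcpt : IsCompact F) (hF : F = T '' (F + D))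
    (heig : ∀ φ : StrongDual ℝ E, φ ≠ 0 →
      finrank ℝ (vectorSpan ℝ (maxFace (convexHull ℝ D) φ)) + 1 = finrank ℝ E →
      ∃ k : ℕ, 1 ≤ k ∧ ∃ μ : ℝ, φ ∘L T ^ k = μ • φ) :
    ∃ V : Set E, V.Finite ∧ convexHull ℝ F = convexHull ℝ V := by
  obtain ⟨K, hK, hinv⟩ := exists_pow_sub_add_mem_convexHull hT hD hint heig
  have hDne : D.Nonempty := convexHull_nonempty_iff.1 (hint.mono interior_subset)
  obtain ⟨_, ⟨V, hV, rfl⟩, hne, hG⟩ := exists_isPolytope_eq_image_add hT hD hDne hK hinv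
  exact ⟨V, hV, convexHull_attractor_eq hT hinj hFne hFcpt hF hV (convexHull_nonempty_iff.1 hne) hG⟩

end Polytopes

theorem dotp_smul_left {n : ℕ} (a : ℝ) (v x : Fin n → ℝ) : dotp (a • v) x = a * dotp v x :=
  smul_dotProduct a v x

theorem exists_dotp_eq {n : ℕ} (φ : (Fin n → ℝ) →ₗ[ℝ] ℝ) :
    ∃ v : Fin n → ℝ, ∀ x, φ x = dotp v x := by
  refine ⟨fun i => φ fun j => if i = j then 1 else 0, fun x => ?_⟩
  rw [φ.pi_apply_eq_sum_univ x]
  simp [dotp, mul_comm]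

theorem exists_dotp_pow_mulVec_eq {n : ℕ} {T : Matrix (Fin n) (Fin n) ℝ} (hdet : IsUnit T.det)
    {v : Fin n → ℝ} (hv : ∑ i, v i ^ 2 = 1) {k : ℕ} {μ : ℝ}
    (h : (T.transpose⁻¹ ^ k) *ᵥ v = μ • v) : ∀ x, dotp v ((T ^ k) *ᵥ x) = μ⁻¹ * dotp v x := by
  have hcancel : (T.transpose ^ k) * (T.transpose⁻¹ ^ k) = 1 := by
    rw [Matrix.inv_pow', Matrix.mul_nonsing_inv]
    rw [Matrix.det_pow, Matrix.det_transpose]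
    exact hdet.pow k
  have key : ∀ x, dotp v x = μ * dotp v ((T ^ k) *ᵥ x) := by
    intro x
    have h1 : v = (T.transpose ^ k) *ᵥ (μ • v) := by
      rw [← h, Matrix.mulVec_mulVec, hcancel, Matrix.one_mulVec]
    have h2 : dotp v ((T ^ k) *ᵥ x) = dotp ((T.transpose ^ k) *ᵥ v) x := by
      change v ⬝ᵥ _ = _ ⬝ᵥ x
      rw [Matrix.dotProduct_mulVec, ← Matrix.transpose_pow, Matrix.mulVec_transpose]
    rw [h2, ← dotp_smul_left, ← Matrix.mulVec_smul, ← h1]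
  have hμ : μ ≠ 0 := by
    rintro rfl
    have h1 := key v
    have h2 : dotp v v = 1 := by
      rw [← hv]
      exact Finset.sum_congr rfl fun i _ => (sq (v i)).symm
    rw [h2, zero_mul] at h1
    exact one_ne_zero h1
  intro x
  rw [key x, inv_mul_cancel_left₀ hμ]

/-- Strichartz–Wang criterion (sufficiency): let `T` be invertible with `‖T‖ < 1`,
`D = {d₁, …, d_q}` with `conv(D)` of dimension `n`, and `F` the attractor of
`{φ_j(x) = T(x + d_j)}`.  If every outward unit normal `v` of every
`(n-1)`-dimensional face of `conv(D)` is an eigenvector of `(Tᵀ)^{-k}` for some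
`k ≥ 1`, then `conv(F)` is a polytope (a convex hull of finitely many points). -/
theorem stmt8 {n q : ℕ} (hq : 0 < q) (T : Matrix (Fin n) (Fin n) ℝ)
    (hdet : IsUnit T.det) (hT : opNorm T < 1) (d : Fin q → (Fin n → ℝ))
    (hfull : Module.finrank ℝ
      (affineSpan ℝ (convexHull ℝ (Set.range d))).direction = n)
    (F : Set (Fin n → ℝ)) (hFne : F.Nonempty) (hFcpt : IsCompact F)
    (hF : F = ⋃ j : Fin q, (fun x => T *ᵥ (x + d j)) '' F)
    (hnormal : ∀ v : Fin n → ℝ, (∑ i, v i ^ 2) = 1 →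
      Module.finrank ℝ
        (affineSpan ℝ (suppFace (convexHull ℝ (Set.range d)) v)).direction = n - 1 →
      ∃ k : ℕ, 1 ≤ k ∧ ∃ μ : ℝ, (T.transpose⁻¹ ^ k) *ᵥ v = μ • v) :
    ∃ V : Finset (Fin n → ℝ), convexHull ℝ F = convexHull ℝ (V : Set (Fin n → ℝ)) := by
  set L : (Fin n → ℝ) ≃L[ℝ] EuclideanSpace ℝ (Fin n) := (EuclideanSpace.equiv (Fin n) ℝ).symm
  set A := Matrix.toEuclideanCLM (𝕜 := ℝ) T with hA
  have hAL : ∀ (k : ℕ) x, (A ^ k) (L x) = L ((T ^ k) *ᵥ x) := fun k x => by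
    rw [hA, ← map_pow]
    rfl
  have hAL1 : ∀ x, A (L x) = L (T *ᵥ x) := fun x => rfl
  have hinj : Function.Injective A := by
    intro x y hxy
    obtain ⟨x, rfl⟩ := L.surjective x
    obtain ⟨y, rfl⟩ := L.surjective y
    rw [hAL1, hAL1] at hxy
    rw [Matrix.mulVec_injective_of_isUnit ((Matrix.isUnit_iff_isUnit_det T).2 hdet)
      (L.injective hxy)]
  have hhull : ∀ s, L '' convexHull ℝ s = convexHull ℝ (L '' s) := fun s =>
    L.toLinearEquiv.toLinearMap.image_convexHull s
  have hint : (interior (convexHull ℝ (L '' Set.range d))).Nonempty := by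
    have : Nonempty (Fin q) := ⟨⟨0, hq⟩⟩
    have htop : (interior (convexHull ℝ (Set.range d))).Nonempty := by
      rw [interior_convexHull_nonempty_iff_affineSpan_eq_top, ← affineSpan_convexHull,
        ← AffineSubspace.direction_eq_top_iff_of_nonempty
          ((affineSpan_nonempty ℝ).2 (Set.range_nonempty d).convexHull)]
      exact Submodule.eq_top_of_finrank_eq (by simpa using hfull)
    rw [← hhull]
    have himg := L.toHomeomorph.image_interior (convexHull ℝ (Set.range d))
    exact himg ▸ htop.image _
  have hF' : L '' F = A '' (open scoped Pointwise in L '' F + L '' Set.range d) := by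
    rw [← Set.image_add, Set.image_image]
    simp only [hAL1]
    rw [← Set.image_image L (T *ᵥ ·)]
    congr 1
    conv_lhs => rw [hF]
    ext x
    simp only [Set.mem_iUnion, Set.mem_image, Set.mem_add, Set.mem_range]
    constructor
    · rintro ⟨j, y, hy, rfl⟩
      exact ⟨_, ⟨y, hy, _, ⟨j, rfl⟩, rfl⟩, rfl⟩
    · rintro ⟨_, ⟨y, hy, _, ⟨j, rfl⟩, rfl⟩, rfl⟩
      exact ⟨j, y, hy, rfl⟩
  obtain ⟨V, hV, hFV⟩ := exists_finite_convexHull_attractor_eq (T := A) hT hinj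
    ((Set.finite_range d).image L) hint (hFne.image L) (hFcpt.image L.continuous) hF' (by
    intro φ hφ0 hdim
    obtain ⟨v, hv⟩ := exists_dotp_eq (φ.toLinearMap ∘ₗ L.toLinearEquiv.toLinearMap)
    replace hv : ∀ x, φ (L x) = dotp v x := hv
    have hv0 : 0 < ∑ i, v i ^ 2 := by
      refine (Finset.sum_nonneg fun i _ => sq_nonneg (v i)).lt_of_ne' fun h0 => hφ0 ?_
      rw [Finset.sum_eq_zero_iff_of_nonneg fun i _ => sq_nonneg (v i)] at h0
      ext x
      obtain ⟨x, rfl⟩ := L.surjective x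
      rw [hv]
      exact Finset.sum_eq_zero fun i hi => by
        rw [(pow_eq_zero_iff two_ne_zero).1 (h0 i hi), zero_mul]
    set s := √(∑ i, v i ^ 2)
    have hs : 0 < s := Real.sqrt_pos.2 hv0
    have hw : ∑ i, (s⁻¹ • v) i ^ 2 = 1 := by
      simp only [Pi.smul_apply, smul_eq_mul, mul_pow, ← Finset.mul_sum]
      rw [inv_pow, Real.sq_sqrt hv0.le, inv_mul_cancel₀ hv0.ne']
    have hface : L '' suppFace (convexHull ℝ (Set.range d)) (s⁻¹ • v) =
        maxFace (convexHull ℝ (L '' Set.range d)) φ := by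
      rw [← hhull]
      ext x
      obtain ⟨x, rfl⟩ := L.surjective x
      simp [suppFace, maxFace, dotp_smul_left, hv, inv_pos.2 hs]
    have hrank : Module.finrank ℝ (affineSpan ℝ
        (suppFace (convexHull ℝ (Set.range d)) (s⁻¹ • v))).direction = n - 1 := by
      rw [← hface] at hdim
      have hmap := L.toLinearEquiv.toLinearMap.toAffineMap.map_vectorSpan
        (s := suppFace (convexHull ℝ (Set.range d)) (s⁻¹ • v))
      have hmap' := LinearEquiv.finrank_map_eq L.toLinearEquiv
        (vectorSpan ℝ (suppFace (convexHull ℝ (Set.range d)) (s⁻¹ • v)))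
      rw [finrank_euclideanSpace, Fintype.card_fin] at hdim
      rw [direction_affineSpan, ← hmap']
      erw [hmap]
      exact Nat.eq_sub_of_add_eq hdim
    obtain ⟨k, hk, μ, hμ⟩ := hnormal _ hw hrank
    refine ⟨k, hk, μ⁻¹, ?_⟩
    ext x
    obtain ⟨x, rfl⟩ := L.surjective x
    have := exists_dotp_pow_mulVec_eq hdet hw hμ x
    rw [dotp_smul_left, dotp_smul_left, mul_left_comm, mul_right_inj' (inv_ne_zero hs.ne')] at this
    change φ ((A ^ k) (L x)) = μ⁻¹ * φ (L x)
    rw [hAL, hv, hv, this])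
  refine ⟨(hV.image L.symm).toFinset, L.injective.image_injective ?_⟩
  rw [hhull, hhull, hFV, Set.Finite.coe_toFinset, L.image_symm_image]
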